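/- Let t ≥ 4 be a fixed integer denoting the speed of the robber. There exists a constant c > 0 such that for every integer n ≥ 486 there exists a connected simple graph G on exactly n vertices whose speed-t cop number is at least c·n^{4/5}. -/

import Mathlib

open SimpleGraph

variable {V : Type*}

/-- The robber, moving with speed `t`, can move from `x` to `y` while the cops occupy
the vertices `cops i`: there is a path of length at most `t` from `x` to `y` that
does not pass through any cop-occupied vertex. -/
def RobberCanMove {k : ℕ} (G : SimpleGraph V) (t : ℕ) (cops : Fin k → V) (x y : V) : Prop :=
  ∃ w : G.Walk x y, w.IsPath ∧ w.length ≤ t ∧ ∀ i : Fin k, cops i ∉ w.support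

/-- A strategy for `k` cops on `G`: an initial placement, and a move function which,
given the current cop positions and the robber's position, tells each cop to stay
where he is or move to an adjacent vertex. -/
structure CopStrategy (G : SimpleGraph V) (k : ℕ) where
  init : Fin k → V
  move : (Fin k → V) → V → (Fin k → V)
  move_valid : ∀ c r i, move c r i = c i ∨ G.Adj (c i) (move c r i)

/-- The sequence of cop positions induced by a cop strategy against
a robber play `r : ℕ → V` (where `r n` is the robber's position in round `n`). -/
def copSeq {G : SimpleGraph V} {k : ℕ} (CS : CopStrategy G k) (r : ℕ → V) : ℕ → Fin k → V
  | 0 => CS.init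
  | n + 1 => CS.move (copSeq CS r n) (r n)

/-- A robber play `r` (with speed `t`) is valid against a cop strategy if, in each round,
the robber either has already been caught or moves along a path of length at most `t`
avoiding the (just moved) cops. -/
def ValidRobberPlay {k : ℕ} (G : SimpleGraph V) (t : ℕ) (CS : CopStrategy G k)
    (r : ℕ → V) : Prop :=
  ∀ n, RobberCanMove G t (copSeq CS r (n + 1)) (r n) (r (n + 1)) ∨
    ∃ i, copSeq CS r (n + 1) i = r n

/-- A cop strategy is winning (against a speed-`t` robber) if in every valid robber play a cop
eventually steps onto the robber's current vertex (or the robber is caught at the start). -/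
def CopsWin {k : ℕ} (G : SimpleGraph V) (t : ℕ) (CS : CopStrategy G k) : Prop :=
  ∀ r : ℕ → V, ValidRobberPlay G t CS r →
    (∃ i, copSeq CS r 0 i = r 0) ∨ ∃ n i, copSeq CS r (n + 1) i = r n

/-- The speed-`t` cop number of `G`: the least number of cops having a winning strategy. -/
noncomputable def copNumber (G : SimpleGraph V) (t : ℕ) : ℕ :=
  sInf { k | ∃ CS : CopStrategy G k, CopsWin G t CS }

section Algebra

variable {K : Type*} [Field K]

lemma no_octagon {b₁ b₂ b₃ b₄ D₁ D₂ D₃ D₄ : K}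
    (h₁ : D₁ ≠ 0) (h₂ : D₂ ≠ 0)
    (h₁₂ : b₁ ≠ b₂) (h₂₃ : b₂ ≠ b₃) (h₃₄ : b₃ ≠ b₄) (h₄₁ : b₄ ≠ b₁)
    (e₀ : D₁ + D₂ + D₃ + D₄ = 0)
    (e₁ : b₁ * D₁ + b₂ * D₂ + b₃ * D₃ + b₄ * D₄ = 0)
    (e₂ : b₁ ^ 2 * D₁ + b₂ ^ 2 * D₂ + b₃ ^ 2 * D₃ + b₄ ^ 2 * D₄ = 0)
    (e₃ : b₁ ^ 3 * D₁ + b₂ ^ 3 * D₂ + b₃ ^ 3 * D₃ + b₄ ^ 3 * D₄ = 0)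
    (q : b₂ * D₂ * (D₁ * (b₂ - b₁) ^ 2)
      + b₃ * D₃ * (D₁ * (b₃ - b₁) ^ 2 + D₂ * (b₃ - b₂) ^ 2)
      + b₄ * D₄ * (D₁ * (b₄ - b₁) ^ 2 + D₂ * (b₄ - b₂) ^ 2 + D₃ * (b₄ - b₃) ^ 2) = 0) :
    False := by
  have f₁ : D₁ * ((b₁ - b₂) * (b₁ - b₃) * (b₁ - b₄)) = 0 := by
    linear_combination e₃ - (b₂ + b₃ + b₄) * e₂ + (b₂ * b₃ + b₃ * b₄ + b₂ * b₄) * e₁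
      - b₂ * b₃ * b₄ * e₀
  have f₂ : D₂ * ((b₂ - b₁) * (b₂ - b₃) * (b₂ - b₄)) = 0 := by
    linear_combination e₃ - (b₁ + b₃ + b₄) * e₂ + (b₁ * b₃ + b₃ * b₄ + b₁ * b₄) * e₁
      - b₁ * b₃ * b₄ * e₀
  have g₁ : b₁ = b₃ := by
    simpa [h₁, sub_eq_zero, h₁₂, h₄₁.symm] using f₁
  have g₂ : b₂ = b₄ := by
    simpa [h₂, sub_eq_zero, h₁₂.symm, h₂₃] using f₂
  subst g₁ g₂
  have k₁ : (D₁ + D₃) * (b₁ - b₂) = 0 := by linear_combination e₁ - b₂ * e₀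
  have k₁' : D₃ = - D₁ := by
    have := (mul_eq_zero.1 k₁).resolve_right (sub_ne_zero.2 h₁₂)
    linear_combination this
  have k₂ : D₄ = - D₂ := by linear_combination e₀ - k₁'
  subst k₁' k₂
  have : D₁ * D₂ * (b₂ - b₁) ^ 3 = 0 := by linear_combination q
  simp [h₁, h₂, sub_eq_zero, h₁₂.symm] at this

lemma no_decagon_of_ne {b₁ b₂ b₃ b₄ b₅ D₁ D₂ D₃ D₄ D₅ : K}
    (h₁ : D₁ ≠ 0)
    (h₁₂ : b₁ ≠ b₂) (h₂₃ : b₂ ≠ b₃) (h₃₄ : b₃ ≠ b₄) (h₄₅ : b₄ ≠ b₅) (h₅₁ : b₅ ≠ b₁)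
    (h₁₃ : b₁ ≠ b₃) (h₂₄ : b₂ ≠ b₄) (h₃₅ : b₃ ≠ b₅) (h₄₁ : b₄ ≠ b₁) (h₅₂ : b₅ ≠ b₂)
    (e₀ : D₁ + D₂ + D₃ + D₄ + D₅ = 0)
    (e₁ : b₁ * D₁ + b₂ * D₂ + b₃ * D₃ + b₄ * D₄ + b₅ * D₅ = 0)
    (e₂ : b₁ ^ 2 * D₁ + b₂ ^ 2 * D₂ + b₃ ^ 2 * D₃ + b₄ ^ 2 * D₄ + b₅ ^ 2 * D₅ = 0)
    (e₃ : b₁ ^ 3 * D₁ + b₂ ^ 3 * D₂ + b₃ ^ 3 * D₃ + b₄ ^ 3 * D₄ + b₅ ^ 3 * D₅ = 0)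
    (q : b₂ * D₂ * (D₁ * (b₂ - b₁) ^ 2)
      + b₃ * D₃ * (D₁ * (b₃ - b₁) ^ 2 + D₂ * (b₃ - b₂) ^ 2)
      + b₄ * D₄ * (D₁ * (b₄ - b₁) ^ 2 + D₂ * (b₄ - b₂) ^ 2 + D₃ * (b₄ - b₃) ^ 2)
      + b₅ * D₅ * (D₁ * (b₅ - b₁) ^ 2 + D₂ * (b₅ - b₂) ^ 2 + D₃ * (b₅ - b₃) ^ 2
        + D₄ * (b₅ - b₄) ^ 2) = 0) :
    False := by
  have key : ∀ x y z : K, D₁ * ((b₁ - x) * (b₁ - y) * (b₁ - z))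
      + D₂ * ((b₂ - x) * (b₂ - y) * (b₂ - z)) + D₃ * ((b₃ - x) * (b₃ - y) * (b₃ - z))
      + D₄ * ((b₄ - x) * (b₄ - y) * (b₄ - z)) + D₅ * ((b₅ - x) * (b₅ - y) * (b₅ - z)) = 0 := by
    intro x y z
    linear_combination e₃ - (x + y + z) * e₂ + (x * y + y * z + x * z) * e₁ - x * y * z * e₀
  have s₁₂ := sub_ne_zero.2 h₁₂
  have s₂₃ := sub_ne_zero.2 h₂₃
  have s₃₄ := sub_ne_zero.2 h₃₄
  have s₄₅ := sub_ne_zero.2 h₄₅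
  have s₅₁ := sub_ne_zero.2 h₅₁
  have s₁₃ := sub_ne_zero.2 h₁₃
  have s₂₄ := sub_ne_zero.2 h₂₄
  have s₃₅ := sub_ne_zero.2 h₃₅
  have s₄₁ := sub_ne_zero.2 h₄₁
  have s₅₂ := sub_ne_zero.2 h₅₂
  obtain ⟨L, hL⟩ : ∃ L, L = D₁ * ((b₁ - b₂) * (b₁ - b₃) * (b₄ - b₁) * (b₅ - b₁)) := ⟨_, rfl⟩
  have hL0 : L ≠ 0 := by
    rw [hL]; simp [h₁, s₁₂, s₁₃, s₄₁, s₅₁]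
  have d₁ : D₁ = L / ((b₁ - b₂) * (b₁ - b₃) * (b₄ - b₁) * (b₅ - b₁)) := by
    rw [hL]; field_simp
  have d₂ : D₂ = L / ((b₁ - b₂) * (b₂ - b₃) * (b₂ - b₄) * (b₅ - b₂)) := by
    rw [eq_div_iff (by simp [*]), hL]
    linear_combination (b₂ - b₁) * key b₃ b₄ b₅
  have d₃ : D₃ = L / ((b₁ - b₃) * (b₂ - b₃) * (b₃ - b₄) * (b₃ - b₅)) := by
    rw [eq_div_iff (by simp [*]), hL]
    linear_combination (b₃ - b₁) * key b₂ b₄ b₅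
  have d₄ : D₄ = L / ((b₄ - b₁) * (b₂ - b₄) * (b₃ - b₄) * (b₄ - b₅)) := by
    rw [eq_div_iff (by simp [*]), hL]
    linear_combination (b₄ - b₁) * key b₂ b₃ b₅
  have d₅ : D₅ = L / ((b₅ - b₁) * (b₅ - b₂) * (b₃ - b₅) * (b₄ - b₅)) := by
    rw [eq_div_iff (by simp [*]), hL]
    linear_combination (b₅ - b₁) * key b₂ b₃ b₄
  have fin : L ^ 2 = 0 := by
    have hq : b₂ * D₂ * (D₁ * (b₂ - b₁) ^ 2)
      + b₃ * D₃ * (D₁ * (b₃ - b₁) ^ 2 + D₂ * (b₃ - b₂) ^ 2)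
      + b₄ * D₄ * (D₁ * (b₄ - b₁) ^ 2 + D₂ * (b₄ - b₂) ^ 2 + D₃ * (b₄ - b₃) ^ 2)
      + b₅ * D₅ * (D₁ * (b₅ - b₁) ^ 2 + D₂ * (b₅ - b₂) ^ 2 + D₃ * (b₅ - b₃) ^ 2
        + D₄ * (b₅ - b₄) ^ 2)
        = - L ^ 2 / ((b₁ - b₃) * (b₂ - b₄) * (b₃ - b₅) * (b₄ - b₁) * (b₅ - b₂)) := by
      clear q key e₀ e₁ e₂ e₃ hL
      subst d₁ d₂ d₃ d₄ d₅
      field_simp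
      ring
    rw [q, eq_comm, div_eq_zero_iff] at hq
    simpa [s₁₃, s₂₄, s₃₅, s₄₁, s₅₂] using hq
  exact hL0 (pow_eq_zero_iff two_ne_zero |>.1 fin)

lemma no_decagon {b₁ b₂ b₃ b₄ b₅ D₁ D₂ D₃ D₄ D₅ : K}
    (h₁ : D₁ ≠ 0) (h₂ : D₂ ≠ 0) (h₃ : D₃ ≠ 0) (h₄ : D₄ ≠ 0) (h₅ : D₅ ≠ 0)
    (h₁₂ : b₁ ≠ b₂) (h₂₃ : b₂ ≠ b₃) (h₃₄ : b₃ ≠ b₄) (h₄₅ : b₄ ≠ b₅) (h₅₁ : b₅ ≠ b₁)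
    (e₀ : D₁ + D₂ + D₃ + D₄ + D₅ = 0)
    (e₁ : b₁ * D₁ + b₂ * D₂ + b₃ * D₃ + b₄ * D₄ + b₅ * D₅ = 0)
    (e₂ : b₁ ^ 2 * D₁ + b₂ ^ 2 * D₂ + b₃ ^ 2 * D₃ + b₄ ^ 2 * D₄ + b₅ ^ 2 * D₅ = 0)
    (e₃ : b₁ ^ 3 * D₁ + b₂ ^ 3 * D₂ + b₃ ^ 3 * D₃ + b₄ ^ 3 * D₄ + b₅ ^ 3 * D₅ = 0)
    (q : b₂ * D₂ * (D₁ * (b₂ - b₁) ^ 2)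
      + b₃ * D₃ * (D₁ * (b₃ - b₁) ^ 2 + D₂ * (b₃ - b₂) ^ 2)
      + b₄ * D₄ * (D₁ * (b₄ - b₁) ^ 2 + D₂ * (b₄ - b₂) ^ 2 + D₃ * (b₄ - b₃) ^ 2)
      + b₅ * D₅ * (D₁ * (b₅ - b₁) ^ 2 + D₂ * (b₅ - b₂) ^ 2 + D₃ * (b₅ - b₃) ^ 2
        + D₄ * (b₅ - b₄) ^ 2) = 0) :
    False := by
  have key : ∀ {x₁ x₂ x₃ x₄ x₅ E₁ E₂ E₃ E₄ E₅ : K}, E₂ ≠ 0 → E₄ ≠ 0 → E₅ ≠ 0 →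
      x₁ ≠ x₂ → x₃ ≠ x₄ → x₄ ≠ x₅ → x₅ ≠ x₁ →
      E₁ + E₂ + E₃ + E₄ + E₅ = 0 →
      x₁ * E₁ + x₂ * E₂ + x₃ * E₃ + x₄ * E₄ + x₅ * E₅ = 0 →
      x₁ ^ 2 * E₁ + x₂ ^ 2 * E₂ + x₃ ^ 2 * E₃ + x₄ ^ 2 * E₄ + x₅ ^ 2 * E₅ = 0 →
      x₁ ^ 3 * E₁ + x₂ ^ 3 * E₂ + x₃ ^ 3 * E₃ + x₄ ^ 3 * E₄ + x₅ ^ 3 * E₅ = 0 → x₁ ≠ x₃ := by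
    intro x₁ x₂ x₃ x₄ x₅ E₁ E₂ E₃ E₄ E₅ h₂ h₄ h₅ h₁₂ h₃₄ h₄₅ h₅₁ e₀ e₁ e₂ e₃ h
    subst h
    have f : E₂ * ((x₂ - x₁) * (x₂ - x₄) * (x₂ - x₅)) = 0 := by
      linear_combination e₃ - (x₁ + x₄ + x₅) * e₂ + (x₁ * x₄ + x₄ * x₅ + x₁ * x₅) * e₁
        - x₁ * x₄ * x₅ * e₀
    have f' : x₂ = x₄ ∨ x₂ = x₅ := by
      simpa [h₂, sub_eq_zero, h₁₂.symm] using f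
    rcases f' with rfl | rfl
    · have g : E₅ * ((x₅ - x₁) * (x₅ - x₂)) = 0 := by
        linear_combination e₂ - (x₁ + x₂) * e₁ + x₁ * x₂ * e₀
      simp [h₅, sub_eq_zero, h₅₁, h₄₅.symm] at g
    · have g : E₄ * ((x₄ - x₁) * (x₄ - x₂)) = 0 := by
        linear_combination e₂ - (x₁ + x₂) * e₁ + x₁ * x₂ * e₀
      simp [h₄, sub_eq_zero, h₃₄.symm, h₄₅] at g
  refine no_decagon_of_ne h₁ h₁₂ h₂₃ h₃₄ h₄₅ h₅₁ ?_ ?_ ?_ ?_ ?_ e₀ e₁ e₂ e₃ q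
  · exact key h₂ h₄ h₅ h₁₂ h₃₄ h₄₅ h₅₁ e₀ e₁ e₂ e₃
  · refine key (x₄ := b₅) (x₅ := b₁) (E₁ := D₂) (E₃ := D₄) h₃ h₅ h₁ h₂₃ h₄₅ h₅₁ h₁₂ ?_ ?_ ?_ ?_
    · linear_combination e₀
    · linear_combination e₁
    · linear_combination e₂
    · linear_combination e₃
  · refine key (x₄ := b₁) (x₅ := b₂) (E₁ := D₃) (E₃ := D₅) h₄ h₁ h₂ h₃₄ h₅₁ h₁₂ h₂₃ ?_ ?_ ?_ ?_
    · linear_combination e₀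
    · linear_combination e₁
    · linear_combination e₂
    · linear_combination e₃
  · refine key (x₄ := b₂) (x₅ := b₃) (E₁ := D₄) (E₃ := D₁) h₅ h₂ h₃ h₄₅ h₁₂ h₂₃ h₃₄ ?_ ?_ ?_ ?_
    · linear_combination e₀
    · linear_combination e₁
    · linear_combination e₂
    · linear_combination e₃
  · refine key (x₄ := b₃) (x₅ := b₄) (E₁ := D₅) (E₃ := D₂) h₁ h₃ h₄ h₅₁ h₂₃ h₃₄ h₄₅ ?_ ?_ ?_ ?_
    · linear_combination e₀
    · linear_combination e₁
    · linear_combination e₂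
    · linear_combination e₃

end Algebra

section HexagonGraph

variable {K : Type*} [Field K]

/-- Incidence between points and lines of the affine part of the split Cayley hexagon. -/
def HexInc (p l : Fin 5 → K) : Prop :=
  p 1 + l 1 = p 0 * l 0 ∧ p 2 + l 2 = p 0 ^ 2 * l 0 ∧ p 3 + l 3 = p 0 ^ 3 * l 0 ∧
    p 4 + l 4 = p 0 * (l 0 * l 2 - l 1 ^ 2)

lemma HexInc.point_ne {p p' l : Fin 5 → K} (h : HexInc p l) (h' : HexInc p' l) (hne : p ≠ p') :
    p 0 ≠ p' 0 := by
  intro h0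
  obtain ⟨h1, h2, h3, h4⟩ := h
  obtain ⟨k1, k2, k3, k4⟩ := h'
  rw [← h0] at k1 k2 k3 k4
  apply hne
  funext i
  fin_cases i
  · exact h0
  · exact add_right_cancel (h1.trans k1.symm)
  · exact add_right_cancel (h2.trans k2.symm)
  · exact add_right_cancel (h3.trans k3.symm)
  · exact add_right_cancel (h4.trans k4.symm)

lemma HexInc.line_ne {p l l' : Fin 5 → K} (h : HexInc p l) (h' : HexInc p l') (hne : l ≠ l') :
    l 0 ≠ l' 0 := by
  intro h0
  obtain ⟨h1, h2, h3, h4⟩ := h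
  obtain ⟨k1, k2, k3, k4⟩ := h'
  rw [← h0] at k1 k2 k3 k4
  have e1 : l 1 = l' 1 := add_left_cancel (h1.trans k1.symm)
  have e2 : l 2 = l' 2 := add_left_cancel (h2.trans k2.symm)
  rw [← e1, ← e2] at k4
  apply hne
  funext i
  fin_cases i
  · exact h0
  · exact e1
  · exact e2
  · exact add_left_cancel (h3.trans k3.symm)
  · exact add_left_cancel (h4.trans k4.symm)

/-- Passing from a line to another one through a common point. -/
lemma HexInc.step {p l l' : Fin 5 → K} (h : HexInc p l) (h' : HexInc p l') :
    l' 1 = l 1 + p 0 * (l' 0 - l 0) ∧ l' 2 = l 2 + p 0 ^ 2 * (l' 0 - l 0) ∧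
      l' 3 = l 3 + p 0 ^ 3 * (l' 0 - l 0) ∧
      l' 4 = l 4 + p 0 * (l' 0 - l 0) * (l 2 - 2 * p 0 * l 1 + p 0 ^ 2 * l 0) := by
  obtain ⟨h1, h2, h3, h4⟩ := h
  obtain ⟨k1, k2, k3, k4⟩ := h'
  have e1 : l' 1 = l 1 + p 0 * (l' 0 - l 0) := by linear_combination k1 - h1
  have e2 : l' 2 = l 2 + p 0 ^ 2 * (l' 0 - l 0) := by linear_combination k2 - h2
  refine ⟨e1, e2, by linear_combination k3 - h3, ?_⟩
  rw [e1, e2] at k4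
  linear_combination k4 - h4

/-- The affine part of the incidence graph of the split Cayley hexagon. -/
def hexGraph (K : Type*) [Field K] : SimpleGraph ((Fin 5 → K) ⊕ (Fin 5 → K)) where
  Adj
    | .inl p, .inr l => HexInc p l
    | .inr l, .inl p => HexInc p l
    | _, _ => False
  symm := ⟨by rintro (p | l) (p' | l') h <;> exact h⟩
  loopless := ⟨by rintro (p | l) h <;> exact h⟩

lemma hexGraph_adj_inl {p : Fin 5 → K} {y} :
    (hexGraph K).Adj (.inl p) y ↔ ∃ l, y = .inr l ∧ HexInc p l := by
  rcases y with p' | l <;> simp [hexGraph]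

lemma hexGraph_adj_inr {l : Fin 5 → K} {y} :
    (hexGraph K).Adj (.inr l) y ↔ ∃ p, y = .inl p ∧ HexInc p l := by
  rcases y with p | l' <;> simp [hexGraph]

lemma hexGraph_ncard_neighborSet (x : (Fin 5 → K) ⊕ (Fin 5 → K)) :
    ((hexGraph K).neighborSet x).ncard = Nat.card K := by
  rcases x with p | l
  · let g : K → (Fin 5 → K) ⊕ (Fin 5 → K) := fun a =>
      .inr ![a, p 0 * a - p 1, p 0 ^ 2 * a - p 2, p 0 ^ 3 * a - p 3,
        p 0 * (a * (p 0 ^ 2 * a - p 2) - (p 0 * a - p 1) ^ 2) - p 4]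
    have hg : Function.Injective g := by
      intro a a' h
      exact congrFun (Sum.inr_injective h) 0
    have : (hexGraph K).neighborSet (.inl p) = Set.range g := by
      ext y
      simp only [SimpleGraph.mem_neighborSet, hexGraph_adj_inl, Set.mem_range]
      constructor
      · rintro ⟨l, rfl, h1, h2, h3, h4⟩
        refine ⟨l 0, congrArg Sum.inr ?_⟩
        have e1 : l 1 = p 0 * l 0 - p 1 := by linear_combination h1
        have e2 : l 2 = p 0 ^ 2 * l 0 - p 2 := by linear_combination h2
        rw [e1, e2] at h4
        funext i
        fin_cases i
        · rfl
        · exact e1.symm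
        · exact e2.symm
        · change _ = l 3
          simp; linear_combination -h3
        · change _ = l 4
          simp; linear_combination -h4
      · rintro ⟨a, rfl⟩
        exact ⟨_, rfl, by simp, by simp, by simp, by simp⟩
    rw [this, ← Set.image_univ, Set.ncard_image_of_injective _ hg, Set.ncard_univ]
  · let g : K → (Fin 5 → K) ⊕ (Fin 5 → K) := fun b =>
      .inl ![b, b * l 0 - l 1, b ^ 2 * l 0 - l 2, b ^ 3 * l 0 - l 3,
        b * (l 0 * l 2 - l 1 ^ 2) - l 4]
    have hg : Function.Injective g := by
      intro a a' h
      exact congrFun (Sum.inl_injective h) 0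
    have : (hexGraph K).neighborSet (.inr l) = Set.range g := by
      ext y
      simp only [SimpleGraph.mem_neighborSet, hexGraph_adj_inr, Set.mem_range]
      constructor
      · rintro ⟨p, rfl, h1, h2, h3, h4⟩
        refine ⟨p 0, congrArg Sum.inl ?_⟩
        funext i
        fin_cases i
        · rfl
        · change _ = p 1
          simp; linear_combination -h1
        · change _ = p 2
          simp; linear_combination -h2
        · change _ = p 3
          simp; linear_combination -h3
        · change _ = p 4
          simp; linear_combination -h4
      · rintro ⟨a, rfl⟩
        exact ⟨_, rfl, by simp, by simp, by simp, by simp⟩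
    rw [this, ← Set.image_univ, Set.ncard_image_of_injective _ hg, Set.ncard_univ]

/-- A cyclic sequence of `m` vertices is a closed non-backtracking walk. -/
def IsClosedNB {W : Type*} (H : SimpleGraph W) (m : ℕ) [NeZero m] (x : Fin m → W) : Prop :=
  ∀ i, H.Adj (x i) (x (i + 1)) ∧ x i ≠ x (i + 2)

lemma IsClosedNB.rotate {W : Type*} {H : SimpleGraph W} {m : ℕ} [NeZero m] {x : Fin m → W}
    (h : IsClosedNB H m x) : IsClosedNB H m (fun i => x (i + 1)) := by
  intro i
  have := h (i + 1)
  rwa [add_right_comm i 1 2] at this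

lemma hexGraph_not_isClosedNB_of_inl (m : ℕ) [NeZero m]
    (h : ∀ x : Fin m → (Fin 5 → K) ⊕ (Fin 5 → K), ∀ p, x 0 = .inl p →
      ¬ IsClosedNB (hexGraph K) m x) (x) : ¬ IsClosedNB (hexGraph K) m x := by
  intro hx
  rcases hx0 : x 0 with p | l
  · exact h x p hx0 hx
  · obtain ⟨p, hp, -⟩ := hexGraph_adj_inr.1 (hx0 ▸ (hx 0).1)
    exact h _ p hp hx.rotate

lemma hexGraph_no_four (x) : ¬ IsClosedNB (hexGraph K) 4 x := by
  refine hexGraph_not_isClosedNB_of_inl 4 (fun x p₁ e0 hx => ?_) x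
  obtain ⟨l₁, e1, i11⟩ := hexGraph_adj_inl.1 (e0 ▸ (hx 0).1)
  obtain ⟨p₂, e2, i21⟩ := hexGraph_adj_inr.1 (e1 ▸ (hx 1).1 : (hexGraph K).Adj _ (x 2))
  obtain ⟨l₂, e3, i22⟩ := hexGraph_adj_inl.1 (e2 ▸ (hx 2).1 : (hexGraph K).Adj _ (x 3))
  obtain ⟨p, e4, i12⟩ := hexGraph_adj_inr.1 (e3 ▸ (hx 3).1 : (hexGraph K).Adj _ (x 0))
  obtain rfl : p₁ = p := Sum.inl_injective (e0.symm.trans e4)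
  have b12 := i11.point_ne i21 (fun h => (hx 0).2 (e0.trans (h ▸ e2.symm)))
  have a12 := i22.line_ne i21 (fun h => (hx 1).2 (e1.trans (h ▸ e3.symm)))
  have s1 := (i12.step i11).1
  have s2 := (i21.step i22).1
  have : (p₁ 0 - p₂ 0) * (l₁ 0 - l₂ 0) = 0 := by linear_combination -s1 - s2
  simp [sub_eq_zero, b12, a12.symm] at this

lemma hexGraph_no_six (x) : ¬ IsClosedNB (hexGraph K) 6 x := by
  refine hexGraph_not_isClosedNB_of_inl 6 (fun x p₁ e0 hx => ?_) x
  obtain ⟨l₁, e1, i11⟩ := hexGraph_adj_inl.1 (e0 ▸ (hx 0).1)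
  obtain ⟨p₂, e2, i21⟩ := hexGraph_adj_inr.1 (e1 ▸ (hx 1).1 : (hexGraph K).Adj _ (x 2))
  obtain ⟨l₂, e3, i22⟩ := hexGraph_adj_inl.1 (e2 ▸ (hx 2).1 : (hexGraph K).Adj _ (x 3))
  obtain ⟨p₃, e4, i32⟩ := hexGraph_adj_inr.1 (e3 ▸ (hx 3).1 : (hexGraph K).Adj _ (x 4))
  obtain ⟨l₃, e5, i33⟩ := hexGraph_adj_inl.1 (e4 ▸ (hx 4).1 : (hexGraph K).Adj _ (x 5))
  obtain ⟨p, e6, i13⟩ := hexGraph_adj_inr.1 (e5 ▸ (hx 5).1 : (hexGraph K).Adj _ (x 0))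
  obtain rfl : p₁ = p := Sum.inl_injective (e0.symm.trans e6)
  have b12 := i11.point_ne i21 (fun h => (hx 0).2 (e0.trans (h ▸ e2.symm)))
  have b31 := i33.point_ne i13 (fun h => (hx 4).2 (e4.trans (h ▸ e0.symm)))
  have a31 := i13.line_ne i11 (fun h => (hx 5).2 (e5.trans (h ▸ e1.symm)))
  obtain ⟨s1, t1, -⟩ := i13.step i11
  obtain ⟨s2, t2, -⟩ := i21.step i22
  obtain ⟨s3, t3, -⟩ := i32.step i33
  have : (l₁ 0 - l₃ 0) * ((p₁ 0 - p₂ 0) * (p₁ 0 - p₃ 0)) = 0 := by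
    linear_combination (p₂ 0 + p₃ 0) * (s1 + s2 + s3) - (t1 + t2 + t3)
  simp [sub_eq_zero, b12, b31.symm, a31.symm] at this

lemma hexGraph_no_eight (x) : ¬ IsClosedNB (hexGraph K) 8 x := by
  refine hexGraph_not_isClosedNB_of_inl 8 (fun x p₁ e0 hx => ?_) x
  obtain ⟨l₁, e1, i11⟩ := hexGraph_adj_inl.1 (e0 ▸ (hx 0).1)
  obtain ⟨p₂, e2, i21⟩ := hexGraph_adj_inr.1 (e1 ▸ (hx 1).1 : (hexGraph K).Adj _ (x 2))
  obtain ⟨l₂, e3, i22⟩ := hexGraph_adj_inl.1 (e2 ▸ (hx 2).1 : (hexGraph K).Adj _ (x 3))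
  obtain ⟨p₃, e4, i32⟩ := hexGraph_adj_inr.1 (e3 ▸ (hx 3).1 : (hexGraph K).Adj _ (x 4))
  obtain ⟨l₃, e5, i33⟩ := hexGraph_adj_inl.1 (e4 ▸ (hx 4).1 : (hexGraph K).Adj _ (x 5))
  obtain ⟨p₄, e6, i43⟩ := hexGraph_adj_inr.1 (e5 ▸ (hx 5).1 : (hexGraph K).Adj _ (x 6))
  obtain ⟨l₄, e7, i44⟩ := hexGraph_adj_inl.1 (e6 ▸ (hx 6).1 : (hexGraph K).Adj _ (x 7))
  obtain ⟨p, e8, i14⟩ := hexGraph_adj_inr.1 (e7 ▸ (hx 7).1 : (hexGraph K).Adj _ (x 0))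
  obtain rfl : p₁ = p := Sum.inl_injective (e0.symm.trans e8)
  have b12 := i11.point_ne i21 (fun h => (hx 0).2 (e0.trans (h ▸ e2.symm)))
  have b23 := i22.point_ne i32 (fun h => (hx 2).2 (e2.trans (h ▸ e4.symm)))
  have b34 := i33.point_ne i43 (fun h => (hx 4).2 (e4.trans (h ▸ e6.symm)))
  have b41 := i44.point_ne i14 (fun h => (hx 6).2 (e6.trans (h ▸ e0.symm)))
  have a41 := i14.line_ne i11 (fun h => (hx 7).2 (e7.trans (h ▸ e1.symm)))
  have a12 := i21.line_ne i22 (fun h => (hx 1).2 (e1.trans (h ▸ e3.symm)))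
  obtain ⟨s1, t1, u1, v1⟩ := i14.step i11
  obtain ⟨s2, t2, u2, v2⟩ := i21.step i22
  obtain ⟨s3, t3, u3, v3⟩ := i32.step i33
  obtain ⟨s4, t4, u4, v4⟩ := i43.step i44
  refine no_octagon (sub_ne_zero.2 a41.symm) (sub_ne_zero.2 a12.symm) b12 b23 b34 b41
    (D₃ := l₃ 0 - l₂ 0) (D₄ := l₄ 0 - l₃ 0) (by ring) ?_ ?_ ?_ ?_
  · linear_combination -(s1 + s2 + s3 + s4)
  · linear_combination -(t1 + t2 + t3 + t4)
  · linear_combination -(u1 + u2 + u3 + u4)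
  · linear_combination -(v1 + v2 + v3 + v4)
      - p₂ 0 * (l₂ 0 - l₁ 0) * ((t1) - 2 * p₂ 0 * (s1))
      - p₃ 0 * (l₃ 0 - l₂ 0) * ((t1 + t2) - 2 * p₃ 0 * (s1 + s2))
      - p₄ 0 * (l₄ 0 - l₃ 0) * ((t1 + t2 + t3) - 2 * p₄ 0 * (s1 + s2 + s3))
      + l₄ 2 * (s1 + s2 + s3 + s4) - 2 * l₄ 1 * (t1 + t2 + t3 + t4) + l₄ 0 * (u1 + u2 + u3 + u4)

lemma hexGraph_no_ten (x) : ¬ IsClosedNB (hexGraph K) 10 x := by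
  refine hexGraph_not_isClosedNB_of_inl 10 (fun x p₁ e0 hx => ?_) x
  obtain ⟨l₁, e1, i11⟩ := hexGraph_adj_inl.1 (e0 ▸ (hx 0).1)
  obtain ⟨p₂, e2, i21⟩ := hexGraph_adj_inr.1 (e1 ▸ (hx 1).1 : (hexGraph K).Adj _ (x 2))
  obtain ⟨l₂, e3, i22⟩ := hexGraph_adj_inl.1 (e2 ▸ (hx 2).1 : (hexGraph K).Adj _ (x 3))
  obtain ⟨p₃, e4, i32⟩ := hexGraph_adj_inr.1 (e3 ▸ (hx 3).1 : (hexGraph K).Adj _ (x 4))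
  obtain ⟨l₃, e5, i33⟩ := hexGraph_adj_inl.1 (e4 ▸ (hx 4).1 : (hexGraph K).Adj _ (x 5))
  obtain ⟨p₄, e6, i43⟩ := hexGraph_adj_inr.1 (e5 ▸ (hx 5).1 : (hexGraph K).Adj _ (x 6))
  obtain ⟨l₄, e7, i44⟩ := hexGraph_adj_inl.1 (e6 ▸ (hx 6).1 : (hexGraph K).Adj _ (x 7))
  obtain ⟨p₅, e8, i54⟩ := hexGraph_adj_inr.1 (e7 ▸ (hx 7).1 : (hexGraph K).Adj _ (x 8))
  obtain ⟨l₅, e9, i55⟩ := hexGraph_adj_inl.1 (e8 ▸ (hx 8).1 : (hexGraph K).Adj _ (x 9))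
  obtain ⟨p, e10, i15⟩ := hexGraph_adj_inr.1 (e9 ▸ (hx 9).1 : (hexGraph K).Adj _ (x 0))
  obtain rfl : p₁ = p := Sum.inl_injective (e0.symm.trans e10)
  have b12 := i11.point_ne i21 (fun h => (hx 0).2 (e0.trans (h ▸ e2.symm)))
  have b23 := i22.point_ne i32 (fun h => (hx 2).2 (e2.trans (h ▸ e4.symm)))
  have b34 := i33.point_ne i43 (fun h => (hx 4).2 (e4.trans (h ▸ e6.symm)))
  have b45 := i44.point_ne i54 (fun h => (hx 6).2 (e6.trans (h ▸ e8.symm)))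
  have b51 := i55.point_ne i15 (fun h => (hx 8).2 (e8.trans (h ▸ e0.symm)))
  have a51 := i15.line_ne i11 (fun h => (hx 9).2 (e9.trans (h ▸ e1.symm)))
  have a12 := i21.line_ne i22 (fun h => (hx 1).2 (e1.trans (h ▸ e3.symm)))
  have a23 := i32.line_ne i33 (fun h => (hx 3).2 (e3.trans (h ▸ e5.symm)))
  have a34 := i43.line_ne i44 (fun h => (hx 5).2 (e5.trans (h ▸ e7.symm)))
  have a45 := i54.line_ne i55 (fun h => (hx 7).2 (e7.trans (h ▸ e9.symm)))
  obtain ⟨s1, t1, u1, v1⟩ := i15.step i11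
  obtain ⟨s2, t2, u2, v2⟩ := i21.step i22
  obtain ⟨s3, t3, u3, v3⟩ := i32.step i33
  obtain ⟨s4, t4, u4, v4⟩ := i43.step i44
  obtain ⟨s5, t5, u5, v5⟩ := i54.step i55
  refine no_decagon (sub_ne_zero.2 a51.symm) (sub_ne_zero.2 a12.symm) (sub_ne_zero.2 a23.symm)
    (sub_ne_zero.2 a34.symm) (sub_ne_zero.2 a45.symm) b12 b23 b34 b45 b51 (by ring) ?_ ?_ ?_ ?_
  · linear_combination -(s1 + s2 + s3 + s4 + s5)
  · linear_combination -(t1 + t2 + t3 + t4 + t5)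
  · linear_combination -(u1 + u2 + u3 + u4 + u5)
  · linear_combination -(v1 + v2 + v3 + v4 + v5)
      - p₂ 0 * (l₂ 0 - l₁ 0) * ((t1) - 2 * p₂ 0 * (s1))
      - p₃ 0 * (l₃ 0 - l₂ 0) * ((t1 + t2) - 2 * p₃ 0 * (s1 + s2))
      - p₄ 0 * (l₄ 0 - l₃ 0) * ((t1 + t2 + t3) - 2 * p₄ 0 * (s1 + s2 + s3))
      - p₅ 0 * (l₅ 0 - l₄ 0) * ((t1 + t2 + t3 + t4) - 2 * p₅ 0 * (s1 + s2 + s3 + s4))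
      + l₅ 2 * (s1 + s2 + s3 + s4 + s5) - 2 * l₅ 1 * (t1 + t2 + t3 + t4 + t5)
      + l₅ 0 * (u1 + u2 + u3 + u4 + u5)

end HexagonGraph

section NonBacktracking

variable {W : Type*} {H : SimpleGraph W}

/-- There is a non-backtracking walk of length `i + 1` starting at `v`, whose later vertices
avoid `Z` and whose last step goes from `u` to `x`. -/
def NB (H : SimpleGraph W) (Z : Finset W) (v : W) : ℕ → W → W → Prop
  | 0, u, x => u = v ∧ H.Adj v x ∧ x ∉ Z
  | i + 1, x, y => ∃ u, NB H Z v i u x ∧ H.Adj x y ∧ y ≠ u ∧ y ∉ Z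

lemma NB.adj {Z : Finset W} {v : W} {i : ℕ} {u x : W} (h : NB H Z v i u x) : H.Adj u x := by
  cases i with
  | zero => obtain ⟨rfl, h, -⟩ := h; exact h
  | succ i => obtain ⟨_, -, h, -⟩ := h; exact h

lemma NB.notMem {Z : Finset W} {v : W} {i : ℕ} {u x : W} (h : NB H Z v i u x) : x ∉ Z := by
  cases i with
  | zero => exact h.2.2
  | succ i => obtain ⟨_, -, -, -, h⟩ := h; exact h

lemma NB.forget {Z : Finset W} {v : W} {i : ℕ} {u x : W} (h : NB H Z v i u x) :
    NB H ∅ v i u x := by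
  induction i generalizing u x with
  | zero => exact ⟨h.1, h.2.1, by simp⟩
  | succ i ih =>
    obtain ⟨t, ht, ha, hne, -⟩ := h
    exact ⟨t, ih ht, ha, hne, by simp⟩

lemma NB.exists_walk {Z : Finset W} {v : W} (hv : v ∉ Z) {i : ℕ} {u x : W}
    (h : NB H Z v i u x) : ∃ p : H.Walk v x, p.length = i + 1 ∧ ∀ y ∈ p.support, y ∉ Z := by
  induction i generalizing u x with
  | zero =>
    refine ⟨.cons h.2.1 .nil, rfl, ?_⟩
    simpa [hv] using h.2.2
  | succ i ih =>
    obtain ⟨t, ht, ha, -, hx⟩ := h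
    obtain ⟨p, hp, hs⟩ := ih ht
    refine ⟨p.concat ha, by simp [hp], ?_⟩
    intro y hy
    rw [SimpleGraph.Walk.support_concat] at hy
    simp only [List.mem_append, List.mem_singleton] at hy
    rcases hy with hy | rfl
    · exact hs y hy
    · exact hx

/-- There are no closed non-backtracking walks of length `4`, `6`, `8` or `10`. -/
structure NoShortEvenCycles (H : SimpleGraph W) : Prop where
  four : ∀ x, ¬ IsClosedNB H 4 x
  six : ∀ x, ¬ IsClosedNB H 6 x
  eight : ∀ x, ¬ IsClosedNB H 8 x
  ten : ∀ x, ¬ IsClosedNB H 10 x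

lemma NoShortEvenCycles.of_injective_hom {W' : Type*} {H' : SimpleGraph W'}
    (h : NoShortEvenCycles H) (f : H' →g H) (hf : Function.Injective f) :
    NoShortEvenCycles H' where
  four x hx := h.four (f ∘ x) fun i => ⟨f.map_adj (hx i).1, hf.ne (hx i).2⟩
  six x hx := h.six (f ∘ x) fun i => ⟨f.map_adj (hx i).1, hf.ne (hx i).2⟩
  eight x hx := h.eight (f ∘ x) fun i => ⟨f.map_adj (hx i).1, hf.ne (hx i).2⟩
  ten x hx := h.ten (f ∘ x) fun i => ⟨f.map_adj (hx i).1, hf.ne (hx i).2⟩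

lemma NB.unique_two (hc : NoShortEvenCycles H) {v x u u' : W}
    (h : NB H ∅ v 1 u x) (h' : NB H ∅ v 1 u' x) : u = u' := by
  obtain ⟨v, ⟨rfl, a1, -⟩, a2, n2, -⟩ := h
  obtain ⟨w, ⟨rfl, b1, -⟩, b2, m2, -⟩ := h'
  by_contra hne
  refine hc.four ![w, u, x, u'] ?_
  simp only [IsClosedNB, Fin.forall_fin_succ]
  simp [a1, a2, b1.symm, b2.symm, n2, n2.symm, hne, Ne.symm hne]

lemma NB.unique_three (hc : NoShortEvenCycles H) {v x u u' : W}
    (h : NB H ∅ v 2 u x) (h' : NB H ∅ v 2 u' x) : u = u' := by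
  obtain ⟨x₁, ⟨v, ⟨rfl, a1, -⟩, a2, n2, -⟩, a3, n3, -⟩ := h
  obtain ⟨y₁, ⟨w, ⟨rfl, b1, -⟩, b2, m2, -⟩, b3, m3, -⟩ := h'
  by_cases h1 : x₁ = y₁
  · subst h1
    exact NB.unique_two hc (v := x₁) ⟨_, ⟨rfl, a2, by simp⟩, a3, n3, by simp⟩
      ⟨_, ⟨rfl, b2, by simp⟩, b3, m3, by simp⟩
  by_contra hne
  refine hc.six ![w, x₁, u, x, u', y₁] ?_
  simp only [IsClosedNB, Fin.forall_fin_succ]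
  simp [a1, a2, a3, b1.symm, b2.symm, b3.symm, n2.symm, n3.symm, m2, m3, hne, Ne.symm h1]

lemma NB.unique_four (hc : NoShortEvenCycles H) {v x u u' : W}
    (h : NB H ∅ v 3 u x) (h' : NB H ∅ v 3 u' x) : u = u' := by
  obtain ⟨x₂, ⟨x₁, ⟨v, ⟨rfl, a1, -⟩, a2, n2, -⟩, a3, n3, -⟩, a4, n4, -⟩ := h
  obtain ⟨y₂, ⟨y₁, ⟨w, ⟨rfl, b1, -⟩, b2, m2, -⟩, b3, m3, -⟩, b4, m4, -⟩ := h'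
  by_cases h1 : x₁ = y₁
  · subst h1
    exact NB.unique_three hc (v := x₁)
      ⟨_, ⟨_, ⟨rfl, a2, by simp⟩, a3, n3, by simp⟩, a4, n4, by simp⟩
      ⟨_, ⟨_, ⟨rfl, b2, by simp⟩, b3, m3, by simp⟩, b4, m4, by simp⟩
  by_contra hne
  refine hc.eight ![w, x₁, x₂, u, x, u', y₂, y₁] ?_
  simp only [IsClosedNB, Fin.forall_fin_succ]
  simp [a1, a2, a3, a4, b1.symm, b2.symm, b3.symm, b4.symm, n2.symm, n3.symm, n4.symm,
    m2, m3, m4, hne, Ne.symm h1]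

lemma NB.unique_five (hc : NoShortEvenCycles H) {v x u u' : W}
    (h : NB H ∅ v 4 u x) (h' : NB H ∅ v 4 u' x) : u = u' := by
  obtain ⟨x₃, ⟨x₂, ⟨x₁, ⟨v, ⟨rfl, a1, -⟩, a2, n2, -⟩, a3, n3, -⟩, a4, n4, -⟩, a5, n5, -⟩ := h
  obtain ⟨y₃, ⟨y₂, ⟨y₁, ⟨w, ⟨rfl, b1, -⟩, b2, m2, -⟩, b3, m3, -⟩, b4, m4, -⟩, b5, m5, -⟩ := h'
  by_cases h1 : x₁ = y₁
  · subst h1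
    exact NB.unique_four hc (v := x₁)
      ⟨_, ⟨_, ⟨_, ⟨rfl, a2, by simp⟩, a3, n3, by simp⟩, a4, n4, by simp⟩, a5, n5, by simp⟩
      ⟨_, ⟨_, ⟨_, ⟨rfl, b2, by simp⟩, b3, m3, by simp⟩, b4, m4, by simp⟩, b5, m5, by simp⟩
  by_contra hne
  refine hc.ten ![w, x₁, x₂, x₃, u, x, u', y₃, y₂, y₁] ?_
  simp only [IsClosedNB, Fin.forall_fin_succ]
  simp [a1, a2, a3, a4, a5, b1.symm, b2.symm, b3.symm, b4.symm, b5.symm, n2.symm, n3.symm,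
    n4.symm, n5.symm, m2, m3, m4, m5, hne, Ne.symm h1]

/-- The penultimate vertex of a non-backtracking walk of length at most five is determined by
its end vertices and its length. -/
lemma NB.unique (hc : NoShortEvenCycles H) {Z Z' : Finset W} {v x u u' : W} {i : ℕ} (hi : i ≤ 4)
    (h : NB H Z v i u x) (h' : NB H Z' v i u' x) : u = u' := by
  replace h := h.forget
  replace h' := h'.forget
  interval_cases i
  · exact h.1.trans h'.1.symm
  · exact NB.unique_two hc h h'
  · exact NB.unique_three hc h h'
  · exact NB.unique_four hc h h'
  · exact NB.unique_five hc h h'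

end NonBacktracking

section Counting

variable {W : Type*} [Fintype W] {H : SimpleGraph W}

open Finset

open Classical in
/-- The end vertices of the non-backtracking walks of length `i` from `v` whose later vertices
avoid `Z`. -/
noncomputable def nbSphere (H : SimpleGraph W) (Z : Finset W) (v : W) : ℕ → Finset W
  | 0 => {v}
  | i + 1 => {x | ∃ u, NB H Z v i u x}

lemma mem_nbSphere_succ {Z : Finset W} {v x : W} {i : ℕ} :
    x ∈ nbSphere H Z v (i + 1) ↔ ∃ u, NB H Z v i u x := by
  simp [nbSphere]

lemma NB.mem_nbSphere {Z : Finset W} {v u x : W} {i : ℕ} (h : NB H Z v i u x) :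
    u ∈ nbSphere H Z v i := by
  cases i with
  | zero => simp [nbSphere, h.1]
  | succ i =>
    obtain ⟨t, ht, -⟩ := h
    exact mem_nbSphere_succ.2 ⟨t, ht⟩

lemma nbSphere_subset (Z : Finset W) (v : W) (i : ℕ) : nbSphere H Z v i ⊆ nbSphere H ∅ v i := by
  cases i with
  | zero => simp [nbSphere]
  | succ i =>
    intro x hx
    obtain ⟨u, hu⟩ := mem_nbSphere_succ.1 hx
    exact mem_nbSphere_succ.2 ⟨u, hu.forget⟩

variable [DecidableEq W] [DecidableRel H.Adj]

/-- The number of walks of length `j` from `c` to `x`. -/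
def walkCount (H : SimpleGraph W) [DecidableRel H.Adj] : ℕ → W → W → ℕ
  | 0, c, x => if c = x then 1 else 0
  | j + 1, c, x => ∑ y ∈ H.neighborFinset x, walkCount H j c y

lemma walkCount_le_of_adj {c c' : W} (h : H.Adj c c') (j : ℕ) (x : W) :
    walkCount H j c' x ≤ walkCount H (j + 1) c x := by
  induction j generalizing x with
  | zero =>
    simp only [walkCount]
    split_ifs with hx
    · subst hx
      simp [h.symm]
    · exact Nat.zero_le _
  | succ j ih =>
    rw [walkCount, walkCount]
    exact sum_le_sum fun y _ => ih y

lemma sum_sum_neighborFinset (s : Finset W) (f : W → ℕ) :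
    ∑ w ∈ s, ∑ y ∈ H.neighborFinset w, f y = ∑ y, f y * #(H.neighborFinset y ∩ s) := by
  have : ∀ w, ∑ y ∈ H.neighborFinset w, f y = ∑ y, if H.Adj y w then f y else 0 := by
    intro w
    rw [← sum_filter]
    refine sum_congr ?_ fun _ _ => rfl
    ext y
    simp [H.adj_comm]
  simp_rw [this]
  rw [sum_comm]
  refine sum_congr rfl fun y _ => ?_
  rw [← sum_filter, sum_const, smul_eq_mul, mul_comm]
  congr 2
  ext w
  simp [and_comm]

lemma sum_walkCount {d : ℕ} (hd : ∀ x, #(H.neighborFinset x) = d) (j : ℕ) (c : W) :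
    ∑ x, walkCount H j c x = d ^ j := by
  induction j with
  | zero => simp [walkCount]
  | succ j ih =>
    simp only [walkCount]
    rw [sum_sum_neighborFinset]
    simp [hd, ← sum_mul, ih, pow_succ]

lemma card_neighborFinset_inter_nbSphere (hc : NoShortEvenCycles H) {d : ℕ}
    (hd : ∀ x, #(H.neighborFinset x) = d) {i : ℕ} (hi : i ≤ 3) (v x : W) :
    #(H.neighborFinset x ∩ nbSphere H ∅ v (i + 1)) ≤
      1 + if x ∈ nbSphere H ∅ v i then d else 0 := by
  split_ifs with hx
  · exact (card_le_card inter_subset_left).trans (by rw [hd]; omega)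
  · have key : ∀ w ∈ H.neighborFinset x ∩ nbSphere H ∅ v (i + 1), NB H ∅ v (i + 1) w x := by
      intro w hw
      rw [mem_inter, SimpleGraph.mem_neighborFinset, mem_nbSphere_succ] at hw
      obtain ⟨ha, u, hu⟩ := hw
      refine ⟨u, hu, ha.symm, ?_, by simp⟩
      rintro rfl
      exact hx hu.mem_nbSphere
    rw [add_zero]
    exact card_le_one.2 fun a ha b hb => NB.unique hc (by omega) (key a ha) (key b hb)

lemma one_le_walkCount {Z : Finset W} {v x : W} {i : ℕ} (hx : x ∈ nbSphere H Z v i) :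
    1 ≤ walkCount H i x v := by
  induction i generalizing x with
  | zero => simp_all [nbSphere, walkCount]
  | succ i ih =>
    obtain ⟨u, hu⟩ := mem_nbSphere_succ.1 hx
    exact (ih hu.mem_nbSphere).trans (walkCount_le_of_adj hu.adj.symm i v)

lemma sum_nbSphere_walkCount (hc : NoShortEvenCycles H) {d : ℕ}
    (hd : ∀ x, #(H.neighborFinset x) = d) (v c : W) (r j : ℕ) (hj : r + j ≤ 4) :
    ∑ w ∈ nbSphere H ∅ v (r + j), walkCount H j c w ≤
      j * d ^ (j - 1) + d ^ j * walkCount H r c v := by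
  induction j with
  | zero =>
    simp only [walkCount, sum_ite_eq]
    split_ifs with h
    · simpa using one_le_walkCount h
    · simp
  | succ j ih =>
    calc ∑ w ∈ nbSphere H ∅ v (r + j + 1), walkCount H (j + 1) c w
        = ∑ y, walkCount H j c y * #(H.neighborFinset y ∩ nbSphere H ∅ v (r + j + 1)) := by
          simp only [walkCount, sum_sum_neighborFinset]
      _ ≤ ∑ y, walkCount H j c y * (1 + if y ∈ nbSphere H ∅ v (r + j) then d else 0) := by
          gcongr
          exact card_neighborFinset_inter_nbSphere hc hd (by omega) v _
      _ = d ^ j + d * ∑ y ∈ nbSphere H ∅ v (r + j), walkCount H j c y := by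
          simp only [mul_add, mul_one, sum_add_distrib, sum_walkCount hd, mul_ite, mul_zero,
            sum_ite_mem, univ_inter, sum_mul, mul_comm d]
      _ ≤ d ^ j + d * (j * d ^ (j - 1) + d ^ j * walkCount H r c v) := by
          gcongr
          exact ih (by omega)
      _ = (j + 1) * d ^ (j + 1 - 1) + d ^ (j + 1) * walkCount H r c v := by
          cases j with
          | zero => simp
          | succ j => simp only [Nat.add_sub_cancel]; ring

lemma card_nbSphere_one {d : ℕ} (hd : ∀ x, #(H.neighborFinset x) = d) (Z : Finset W) (v : W) :
    d ≤ #(nbSphere H Z v 1) + #(Z ∩ nbSphere H ∅ v 1) := by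
  rw [← hd v]
  refine (card_le_card fun x hx => ?_).trans (card_union_le _ _)
  rw [SimpleGraph.mem_neighborFinset] at hx
  rw [mem_union, mem_inter, mem_nbSphere_succ, mem_nbSphere_succ]
  by_cases hZ : x ∈ Z
  · exact Or.inr ⟨hZ, v, rfl, hx, by simp⟩
  · exact Or.inl ⟨v, rfl, hx, hZ⟩

lemma card_nbSphere_succ (hc : NoShortEvenCycles H) {d : ℕ}
    (hd : ∀ x, #(H.neighborFinset x) = d) (Z : Finset W) (v : W) {i : ℕ} (hi : i ≤ 3) :
    (d - 1) * #(nbSphere H Z v (i + 1)) ≤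
      #(nbSphere H Z v (i + 2)) + #(Z ∩ nbSphere H ∅ v (i + 2)) := by
  have hp : ∀ x, ∃ u, x ∈ nbSphere H Z v (i + 1) → NB H Z v i u x := by
    intro x
    by_cases hx : x ∈ nbSphere H Z v (i + 1)
    · obtain ⟨u, hu⟩ := mem_nbSphere_succ.1 hx
      exact ⟨u, fun _ => hu⟩
    · exact ⟨x, fun h => absurd h hx⟩
  choose p hp using hp
  have hdisj : (nbSphere H Z v (i + 1) : Set W).PairwiseDisjoint
      fun x => (H.neighborFinset x).erase (p x) := by
    intro x hx x' hx' hne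
    refine disjoint_left.2 fun y hy hy' => hne ?_
    rw [mem_erase, SimpleGraph.mem_neighborFinset] at hy hy'
    exact NB.unique hc (v := v) (x := y) (i := i + 1) (Z := ∅) (Z' := ∅) (by omega)
      ⟨_, (hp x hx).forget, hy.2, hy.1, by simp⟩ ⟨_, (hp x' hx').forget, hy'.2, hy'.1, by simp⟩
  calc (d - 1) * #(nbSphere H Z v (i + 1))
      = ∑ x ∈ nbSphere H Z v (i + 1), #((H.neighborFinset x).erase (p x)) := by
        rw [mul_comm, ← smul_eq_mul, ← sum_const]
        refine sum_congr rfl fun x hx => ?_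
        rw [card_erase_of_mem, hd]
        simpa using (hp x hx).adj.symm
    _ = #((nbSphere H Z v (i + 1)).biUnion fun x => (H.neighborFinset x).erase (p x)) :=
        (card_biUnion hdisj).symm
    _ ≤ #(nbSphere H Z v (i + 2) ∪ (Z ∩ nbSphere H ∅ v (i + 2))) := by
        refine card_le_card fun y hy => ?_
        rw [mem_biUnion] at hy
        obtain ⟨x, hx, hy⟩ := hy
        rw [mem_erase, SimpleGraph.mem_neighborFinset] at hy
        rw [mem_union, mem_inter, mem_nbSphere_succ, mem_nbSphere_succ]
        by_cases hZ : y ∈ Z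
        · exact Or.inr ⟨hZ, x, _, (hp x hx).forget, hy.2, hy.1, by simp⟩
        · exact Or.inl ⟨x, _, hp x hx, hy.2, hy.1, hZ⟩
    _ ≤ _ := card_union_le _ _

lemma card_nbSphere_four (hc : NoShortEvenCycles H) {d : ℕ}
    (hd : ∀ x, #(H.neighborFinset x) = d) (Z : Finset W) (v : W) :
    (d - 1) ^ 3 * d ≤ #(nbSphere H Z v 4) + (d - 1) ^ 3 * #(Z ∩ nbSphere H ∅ v 1) +
      (d - 1) ^ 2 * #(Z ∩ nbSphere H ∅ v 2) + (d - 1) * #(Z ∩ nbSphere H ∅ v 3) +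
      #(Z ∩ nbSphere H ∅ v 4) := by
  have h₁ := Nat.mul_le_mul_left ((d - 1) ^ 3) (card_nbSphere_one hd Z v)
  have h₂ := Nat.mul_le_mul_left ((d - 1) ^ 2) (card_nbSphere_succ hc hd Z v (i := 0) (by omega))
  have h₃ := Nat.mul_le_mul_left (d - 1) (card_nbSphere_succ hc hd Z v (i := 1) (by omega))
  have h₄ := card_nbSphere_succ hc hd Z v (i := 2) (by omega)
  ring_nf at *
  omega

lemma card_nbSphere_five (hc : NoShortEvenCycles H) {d : ℕ}
    (hd : ∀ x, #(H.neighborFinset x) = d) (v : W) :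
    (d - 1) ^ 4 * d ≤ #(nbSphere H ∅ v 5) := by
  have h₁ := Nat.mul_le_mul_left (d - 1) (card_nbSphere_four hc hd ∅ v)
  have h₂ := card_nbSphere_succ hc hd ∅ v (i := 3) (by omega)
  simp only [empty_inter, card_empty, mul_zero, add_zero] at h₁ h₂
  calc (d - 1) ^ 4 * d = (d - 1) * ((d - 1) ^ 3 * d) := by ring
    _ ≤ _ := h₁.trans h₂

end Counting

section Robber

open Finset

lemma card_filter_mul_le {α : Type*} {s : Finset α} (f : α → ℕ) (m a : ℕ) :
    #{x ∈ s | m < a * f x} * m ≤ a * ∑ x ∈ s, f x := by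
  rw [mul_sum, ← smul_eq_mul, ← sum_const]
  calc _ ≤ ∑ x ∈ s with m < a * f x, a * f x :=
        sum_le_sum fun x hx => (mem_filter.1 hx).2.le
    _ ≤ _ := sum_le_sum_of_subset (filter_subset _ _)

lemma card_filter_pos_le {α : Type*} {s : Finset α} (f : α → ℕ) :
    #{x ∈ s | f x ≠ 0} ≤ ∑ x ∈ s, f x := by
  rw [card_filter]
  refine sum_le_sum fun x _ => ?_
  split_ifs with h
  · exact Nat.one_le_iff_ne_zero.2 h
  · exact Nat.zero_le _

variable {W : Type*} [Fintype W] [DecidableEq W] {H : SimpleGraph W} [DecidableRel H.Adj]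

/-- The number of walks of length `j` from the cop positions `c` to `x`. -/
def threat (H : SimpleGraph W) [DecidableRel H.Adj] {k : ℕ} (c : Fin k → W) (j : ℕ) (x : W) : ℕ :=
  ∑ i, walkCount H j (c i) x

/-- The vertex `v` is not threatened at once, and few cops are close to it. -/
structure IsSafe (H : SimpleGraph W) [DecidableRel H.Adj] (d : ℕ) {k : ℕ} (c : Fin k → W)
    (v : W) : Prop where
  zero : threat H c 0 v = 0
  one : threat H c 1 v = 0
  two : 16 * threat H c 2 v ≤ d
  three : 16 * threat H c 3 v ≤ d ^ 2
  four : 16 * threat H c 4 v ≤ d ^ 3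

lemma threat_zero_eq_zero {k : ℕ} {c : Fin k → W} {v : W} :
    threat H c 0 v = 0 ↔ ∀ i, c i ≠ v := by
  simp [threat, walkCount]

lemma threat_move_le {k : ℕ} {c c' : Fin k → W} (h : ∀ i, c' i = c i ∨ H.Adj (c i) (c' i))
    (j : ℕ) (v : W) : threat H c' j v ≤ threat H c j v + threat H c (j + 1) v := by
  rw [threat, threat, threat, ← sum_add_distrib]
  refine sum_le_sum fun i _ => ?_
  rcases h i with h | h
  · rw [h]; exact Nat.le_add_right _ _
  · exact (walkCount_le_of_adj h j v).trans (Nat.le_add_left _ _)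

lemma card_image_inter_nbSphere_le {k : ℕ} (c : Fin k → W) (v : W) (i : ℕ) :
    #(univ.image c ∩ nbSphere H ∅ v i) ≤ threat H c i v := by
  calc #(univ.image c ∩ nbSphere H ∅ v i)
      ≤ #({s | c s ∈ nbSphere H ∅ v i} : Finset (Fin k)) := by
        refine (card_le_card fun x hx => ?_).trans (card_image_le (f := c))
        obtain ⟨hx, hx'⟩ := mem_inter.1 hx
        obtain ⟨s, -, rfl⟩ := mem_image.1 hx
        exact mem_image_of_mem _ (by simpa using hx')
    _ ≤ threat H c i v := by
        rw [card_filter, threat]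
        refine sum_le_sum fun s _ => ?_
        split_ifs with hs
        · exact one_le_walkCount hs
        · exact Nat.zero_le _

lemma sum_nbSphere_threat (hc : NoShortEvenCycles H) {d : ℕ}
    (hd : ∀ x, #(H.neighborFinset x) = d) {k : ℕ} (c : Fin k → W) (v : W) (r j : ℕ)
    (hj : r + j = 4) :
    ∑ w ∈ nbSphere H ∅ v 4, threat H c j w ≤
      k * (j * d ^ (j - 1)) + d ^ j * threat H c r v := by
  simp only [threat]
  rw [sum_comm, mul_sum]
  calc _ ≤ ∑ i, (j * d ^ (j - 1) + d ^ j * walkCount H r (c i) v) := by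
        refine sum_le_sum fun i _ => ?_
        rw [← hj]
        exact sum_nbSphere_walkCount hc hd v (c i) r j hj.le
    _ = _ := by simp [sum_add_distrib]

lemma sum_threat {d : ℕ} (hd : ∀ x, #(H.neighborFinset x) = d) {k : ℕ} (c : Fin k → W) (j : ℕ) :
    ∑ x, threat H c j x = k * d ^ j := by
  simp only [threat]
  rw [sum_comm]
  simp [sum_walkCount hd]

lemma exists_isSafe (hc : NoShortEvenCycles H) {d : ℕ} (hd16 : 16 ≤ d)
    (hd : ∀ x, #(H.neighborFinset x) = d) [Nonempty W] {k : ℕ} (hk : 1200 * k ≤ d ^ 4)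
    (c : Fin k → W) : ∃ v, IsSafe H d c v := by
  have hd0 : 0 < d := by omega
  by_contra! hno
  have hcover : (univ : Finset W) ⊆
      {x ∈ (univ : Finset W) | threat H c 0 x ≠ 0} ∪
        ({x ∈ (univ : Finset W) | threat H c 1 x ≠ 0} ∪
          ({x ∈ (univ : Finset W) | d < 16 * threat H c 2 x} ∪
            ({x ∈ (univ : Finset W) | d ^ 2 < 16 * threat H c 3 x} ∪
              {x ∈ (univ : Finset W) | d ^ 3 < 16 * threat H c 4 x}))) := by
    intro x _
    by_contra hx
    simp only [mem_union, mem_filter, mem_univ, true_and, not_or, not_not, not_lt] at hx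
    exact hno x ⟨hx.1, hx.2.1, hx.2.2.1, hx.2.2.2.1, hx.2.2.2.2⟩
  have h₀ := card_filter_pos_le (s := univ) (threat H c 0)
  have h₁ := card_filter_pos_le (s := univ) (threat H c 1)
  have h₂ := card_filter_mul_le (s := univ) (threat H c 2) d 16
  have h₃ := card_filter_mul_le (s := univ) (threat H c 3) (d ^ 2) 16
  have h₄ := card_filter_mul_le (s := univ) (threat H c 4) (d ^ 3) 16
  rw [sum_threat hd] at h₀ h₁ h₂ h₃ h₄
  replace h₂ := Nat.le_of_mul_le_mul_right (h₂.trans_eq (by ring : _ = (16 * k * d) * d)) hd0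
  replace h₃ := Nat.le_of_mul_le_mul_right
    (h₃.trans_eq (by ring : _ = (16 * k * d) * d ^ 2)) (by positivity)
  replace h₄ := Nat.le_of_mul_le_mul_right
    (h₄.trans_eq (by ring : _ = (16 * k * d) * d ^ 3)) (by positivity)
  have hcard := (card_le_card hcover).trans ((card_union_le _ _).trans (Nat.add_le_add_left
    ((card_union_le _ _).trans (Nat.add_le_add_left ((card_union_le _ _).trans
      (Nat.add_le_add_left (card_union_le _ _) _)) _)) _))
  have h₅ := (card_nbSphere_five hc hd (Classical.arbitrary W)).trans (card_le_univ _)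
  rw [card_univ] at hcard
  have h₆ : (d - 1) ^ 4 * d ≤ k + 49 * (k * d) := by
    simp only [pow_zero, mul_one, pow_one] at h₀ h₁
    have : 16 * k * d = 16 * (k * d) := by ring
    omega
  obtain ⟨e, rfl⟩ : ∃ e, d = e + 1 := ⟨d - 1, by omega⟩
  rw [Nat.add_sub_cancel] at h₆
  have he : 15 ≤ e := by omega
  have h₇ : 1200 * (e ^ 4 * (e + 1)) ≤ 50 * ((e + 1) ^ 4 * (e + 1)) := by
    calc 1200 * (e ^ 4 * (e + 1)) ≤ 1200 * (k + 49 * (k * (e + 1))) := by gcongr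
      _ ≤ 1200 * (50 * (k * (e + 1))) := by
          have : k ≤ k * (e + 1) := Nat.le_mul_of_pos_right _ (by omega)
          omega
      _ = 50 * (1200 * k * (e + 1)) := by ring
      _ ≤ _ := by gcongr
  have h₈ : 24 * e ^ 4 ≤ (e + 1) ^ 4 := by
    have : (24 * e ^ 4) * (50 * (e + 1)) ≤ (e + 1) ^ 4 * (50 * (e + 1)) := by linarith
    exact Nat.le_of_mul_le_mul_right this (by positivity)
  have h₉ : (e + 1) ^ 4 ≤ (2 * e) ^ 4 := by gcongr; omega
  have : 0 < e ^ 4 := by positivity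
  have : (2 * e) ^ 4 = 16 * e ^ 4 := by ring
  omega

lemma exists_isSafe_of_move (hc : NoShortEvenCycles H) {d : ℕ} (hd16 : 16 ≤ d)
    (hd : ∀ x, #(H.neighborFinset x) = d) {k : ℕ} (hk : 1200 * k ≤ d ^ 4)
    {c c' : Fin k → W} (hmove : ∀ i, c' i = c i ∨ H.Adj (c i) (c' i)) {v : W}
    (hv : IsSafe H d c v) :
    threat H c' 0 v = 0 ∧ ∃ w ∈ nbSphere H (univ.image c') v 4, IsSafe H d c' w := by
  have hd0 : 0 < d := by omega
  have t₀ : threat H c' 0 v = 0 := by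
    have : threat H c' 0 v ≤ threat H c 0 v + threat H c 1 v := threat_move_le hmove 0 v
    have := hv.zero
    have := hv.one
    omega
  have t₁ : 16 * threat H c' 1 v ≤ d := by
    have : threat H c' 1 v ≤ threat H c 1 v + threat H c 2 v := threat_move_le hmove 1 v
    have := hv.one
    have := hv.two
    omega
  have t₂ : 16 * threat H c' 2 v ≤ d + d ^ 2 := by
    have : threat H c' 2 v ≤ threat H c 2 v + threat H c 3 v := threat_move_le hmove 2 v
    have := hv.two
    have := hv.three
    omega
  have t₃ : 16 * threat H c' 3 v ≤ d ^ 2 + d ^ 3 := by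
    have : threat H c' 3 v ≤ threat H c 3 v + threat H c 4 v := threat_move_le hmove 3 v
    have := hv.three
    have := hv.four
    omega
  refine ⟨t₀, ?_⟩
  by_contra! hno
  set S := nbSphere H ∅ v 4 with hS
  have hcover : nbSphere H (univ.image c') v 4 ⊆
      {x ∈ S | threat H c' 1 x ≠ 0} ∪ ({x ∈ S | d < 16 * threat H c' 2 x} ∪
        ({x ∈ S | d ^ 2 < 16 * threat H c' 3 x} ∪ {x ∈ S | d ^ 3 < 16 * threat H c' 4 x})) := by
    intro x hx
    have hxS : x ∈ S := nbSphere_subset _ _ _ hx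
    by_contra hx'
    simp only [mem_union, mem_filter, hxS, true_and, not_or, not_not, not_lt] at hx'
    refine hno x hx ⟨threat_zero_eq_zero.2 fun i hi => ?_, hx'.1, hx'.2.1, hx'.2.2.1, hx'.2.2.2⟩
    obtain ⟨u, hu⟩ := mem_nbSphere_succ.1 hx
    exact hu.notMem (hi ▸ mem_image_of_mem c' (mem_univ i))
  have h₁ := (card_filter_pos_le (s := S) (threat H c' 1)).trans
    (sum_nbSphere_threat hc hd c' v 3 1 rfl)
  have h₂ := (card_filter_mul_le (s := S) (threat H c' 2) d 16).trans
    (Nat.mul_le_mul_left _ (sum_nbSphere_threat hc hd c' v 2 2 rfl))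
  have h₃ := (card_filter_mul_le (s := S) (threat H c' 3) (d ^ 2) 16).trans
    (Nat.mul_le_mul_left _ (sum_nbSphere_threat hc hd c' v 1 3 rfl))
  have h₄ := (card_filter_mul_le (s := S) (threat H c' 4) (d ^ 3) 16).trans
    (Nat.mul_le_mul_left _ (sum_nbSphere_threat hc hd c' v 0 4 rfl))
  have hcard := (card_le_card hcover).trans ((card_union_le _ _).trans (Nat.add_le_add_left
    ((card_union_le _ _).trans (Nat.add_le_add_left (card_union_le _ _) _)) _))
  have z₁ := card_image_inter_nbSphere_le (H := H) c' v 1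
  have z₂ := card_image_inter_nbSphere_le (H := H) c' v 2
  have z₃ := card_image_inter_nbSphere_le (H := H) c' v 3
  have z₄ : #(univ.image c' ∩ nbSphere H ∅ v 4) ≤ k :=
    (card_le_card inter_subset_left).trans (card_image_le.trans (by simp))
  have hlow := card_nbSphere_four hc hd (univ.image c') v
  rw [t₀] at h₄
  simp only [Nat.add_one_sub_one, pow_zero, pow_one, mul_one, mul_zero, add_zero] at h₁ h₂ h₃ h₄
  generalize #{x ∈ S | threat H c' 1 x ≠ 0} = n₁ at *
  generalize #{x ∈ S | d < 16 * threat H c' 2 x} = n₂ at *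
  generalize #{x ∈ S | d ^ 2 < 16 * threat H c' 3 x} = n₃ at *
  generalize #{x ∈ S | d ^ 3 < 16 * threat H c' 4 x} = n₄ at *
  generalize #(nbSphere H (univ.image c') v 4) = n at *
  generalize threat H c' 1 v = f₁ at *
  generalize threat H c' 2 v = f₂ at *
  generalize threat H c' 3 v = f₃ at *
  generalize #(univ.image c' ∩ nbSphere H ∅ v 1) = m₁ at *
  generalize #(univ.image c' ∩ nbSphere H ∅ v 2) = m₂ at *
  generalize #(univ.image c' ∩ nbSphere H ∅ v 3) = m₃ at *
  generalize #(univ.image c' ∩ nbSphere H ∅ v 4) = m₄ at *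
  replace h₁ : 16 * n₁ ≤ 16 * k + d ^ 3 + d ^ 4 := by nlinarith
  replace h₂ : n₂ ≤ 32 * k + (d ^ 2 + d ^ 3) := by
    refine Nat.le_of_mul_le_mul_right (h₂.trans ?_) hd0
    calc _ = (32 * k) * d + d ^ 2 * (16 * f₂) := by ring
      _ ≤ (32 * k) * d + d ^ 2 * (d + d ^ 2) := by gcongr
      _ = _ := by ring
  replace h₃ : n₃ ≤ 48 * k + d ^ 2 := by
    refine Nat.le_of_mul_le_mul_right (h₃.trans ?_) (pow_pos hd0 2)
    calc _ = (48 * k) * d ^ 2 + d ^ 3 * (16 * f₁) := by ring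
      _ ≤ (48 * k) * d ^ 2 + d ^ 3 * d := by gcongr
      _ = _ := by ring
  replace h₄ : n₄ ≤ 64 * k := by
    refine Nat.le_of_mul_le_mul_right (h₄.trans_eq ?_) (pow_pos hd0 3)
    ring
  have hblock : 16 * ((d - 1) ^ 3 * m₁ + (d - 1) ^ 2 * m₂ + (d - 1) * m₃ + m₄) ≤
      3 * d ^ 4 + 2 * d ^ 3 + 16 * k := by
    have hle : d - 1 ≤ d := Nat.sub_le _ _
    calc _ ≤ 16 * (d ^ 3 * f₁ + d ^ 2 * f₂ + d * f₃ + k) := by gcongr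
      _ = d ^ 3 * (16 * f₁) + d ^ 2 * (16 * f₂) + d * (16 * f₃) + 16 * k := by ring
      _ ≤ d ^ 3 * d + d ^ 2 * (d + d ^ 2) + d * (d ^ 2 + d ^ 3) + 16 * k := by gcongr
      _ = _ := by ring
  have htotal : 16 * ((d - 1) ^ 3 * d) ≤ 4 * d ^ 4 + 19 * d ^ 3 + 32 * d ^ 2 + 2336 * k := by
    omega
  obtain ⟨e, rfl⟩ : ∃ e, d = e + 1 := ⟨d - 1, by omega⟩
  rw [Nat.add_sub_cancel] at htotal
  have he : 15 ≤ e := by omega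
  have hfin : 16 * (e ^ 3 * (e + 1)) ≤ 6 * (e + 1) ^ 4 + 19 * (e + 1) ^ 3 + 32 * (e + 1) ^ 2 := by
    omega
  obtain ⟨g, rfl⟩ : ∃ g, e = g + 15 := ⟨e - 15, by omega⟩
  ring_nf at hfin
  omega

end Robber

section Game

lemma not_copsWin_of_invariant {G : SimpleGraph V} {t k : ℕ} {CS : CopStrategy G k}
    (P : (Fin k → V) → V → Prop) (hinit : ∃ v, P CS.init v) (hne : ∀ c v, P c v → ∀ i, c i ≠ v)
    (hstep : ∀ c v, P c v → ∃ w, RobberCanMove G t (CS.move c v) v w ∧ P (CS.move c v) w) :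
    ¬ CopsWin G t CS := by
  intro hwin
  choose! next hnext using hstep
  obtain ⟨v₀, hv₀⟩ := hinit
  let st : ℕ → (Fin k → V) × V := fun n =>
    Nat.rec (CS.init, v₀) (fun _ s => (CS.move s.1 s.2, next s.1 s.2)) n
  have hst : ∀ n, copSeq CS (fun m => (st m).2) n = (st n).1 := by
    intro n
    induction n with
    | zero => rfl
    | succ n ih => rw [copSeq, ih]
  have hP : ∀ n, P (st n).1 (st n).2 := by
    intro n
    induction n with
    | zero => exact hv₀
    | succ n ih => exact (hnext _ _ ih).2
  have hmove : ∀ n, RobberCanMove G t (st (n + 1)).1 (st n).2 (st (n + 1)).2 :=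
    fun n => (hnext _ _ (hP n)).1
  rcases hwin (fun m => (st m).2) fun n => .inl (by rw [hst]; exact hmove n) with
    ⟨i, hi⟩ | ⟨n, i, hi⟩
  · exact hne _ _ hv₀ i hi
  · rw [hst] at hi
    obtain ⟨w, -, -, hw⟩ := hmove n
    apply hw i
    rw [hi]
    exact w.start_mem_support

lemma exists_copsWin_copNumber [Fintype V] (G : SimpleGraph V) (t : ℕ) :
    ∃ CS : CopStrategy G (copNumber G t), CopsWin G t CS := by
  let e := Fintype.equivFin V
  exact Nat.sInf_mem (s := {k | ∃ CS : CopStrategy G k, CopsWin G t CS})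
    ⟨Fintype.card V, ⟨e.symm, fun c _ => c, fun _ _ _ => .inl rfl⟩,
      fun r _ => .inl ⟨e (r 0), e.symm_apply_apply _⟩⟩

lemma copNumber_pos [Fintype V] [Nonempty V] (G : SimpleGraph V) (t : ℕ) : 0 < copNumber G t := by
  refine Nat.pos_of_ne_zero fun h0 => ?_
  obtain ⟨CS, hCS⟩ := exists_copsWin_copNumber G t
  have : IsEmpty (Fin (copNumber G t)) := by rw [h0]; infer_instance
  exact not_copsWin_of_invariant (fun _ _ => True) ⟨Classical.arbitrary V, trivial⟩
    (fun _ _ _ i => isEmptyElim i)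
    (fun _ v _ => ⟨v, ⟨.nil, .nil, Nat.zero_le _, fun i => isEmptyElim i⟩, trivial⟩) hCS

open Finset in
lemma lt_copNumber_of_retract [Fintype V] {W : Type*} [Fintype W] [DecidableEq W] [Nonempty W]
    {H : SimpleGraph W} [DecidableRel H.Adj] (hc : NoShortEvenCycles H) {d : ℕ} (hd16 : 16 ≤ d)
    (hd : ∀ x, #(H.neighborFinset x) = d) {G : SimpleGraph V} (f : H →g G) (ρ : V → W)
    (hρ : ∀ x, ρ (f x) = x) (hadj : ∀ u v, G.Adj u v → ρ v = ρ u ∨ H.Adj (ρ u) (ρ v))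
    {t : ℕ} (ht : 4 ≤ t) : d ^ 4 < 1200 * copNumber G t := by
  by_contra! hk
  obtain ⟨CS, hCS⟩ := exists_copsWin_copNumber G t
  refine not_copsWin_of_invariant (CS := CS)
    (fun c v => ∃ x, v = f x ∧ IsSafe H d (ρ ∘ c) x) ?_ ?_ ?_ hCS
  · obtain ⟨x, hx⟩ := exists_isSafe hc hd16 hd hk (ρ ∘ CS.init)
    exact ⟨f x, x, rfl, hx⟩
  · rintro c _ ⟨x, rfl, hx⟩ i hi
    exact threat_zero_eq_zero.1 hx.zero i (by simp [hi, hρ])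
  · rintro c _ ⟨x, rfl, hx⟩
    have hmove : ∀ i, (ρ ∘ CS.move c (f x)) i = (ρ ∘ c) i ∨
        H.Adj ((ρ ∘ c) i) ((ρ ∘ CS.move c (f x)) i) := by
      intro i
      rcases CS.move_valid c (f x) i with h | h
      · exact .inl (by simp [h])
      · exact hadj _ _ h
    obtain ⟨h0, w, hw, hsafe⟩ := exists_isSafe_of_move hc hd16 hd hk hmove hx
    obtain ⟨u, hu⟩ := mem_nbSphere_succ.1 hw
    obtain ⟨p, hp, hpZ⟩ := hu.exists_walk (by simpa using threat_zero_eq_zero.1 h0)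
    classical
    refine ⟨f w, ⟨(p.map f).bypass, (p.map f).bypass_isPath,
      ((p.map f).length_bypass_le_length).trans (by rw [Walk.length_map, hp]; exact ht),
      fun i hi => ?_⟩, w, rfl, hsafe⟩
    have := (p.map f).support_bypass_subset_support hi
    rw [Walk.support_map, List.mem_map] at this
    obtain ⟨y, hy, hyi⟩ := this
    exact hpZ y hy (mem_image.2 ⟨i, mem_univ i, by simp [← hyi, hρ]⟩)

end Game

section Construction

open Finset

/-- The graph `H` embedded along `e`, with every vertex outside the range of `e` attached to
`e w₀` as a pendant vertex. -/
def pendantExtension {W : Type*} (H : SimpleGraph W) (e : W ↪ V) (w₀ : W) : SimpleGraph V :=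
  H.map e ⊔ fromRel fun u v => u = e w₀ ∧ v ∉ Set.range e

/-- The inclusion of `H` in its pendant extension. -/
def pendantExtensionHom {W : Type*} (H : SimpleGraph W) (e : W ↪ V) (w₀ : W) :
    H →g pendantExtension H e w₀ :=
  ⟨e, fun h => .inl (SimpleGraph.map_adj_apply.2 h)⟩

lemma pendantExtension_connected {W : Type*} {H : SimpleGraph W} (hH : H.Connected) (e : W ↪ V)
    (w₀ : W) : (pendantExtension H e w₀).Connected := by
  have key : ∀ v, (pendantExtension H e w₀).Reachable (e w₀) v := by
    intro v
    by_cases hv : v ∈ Set.range e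
    · obtain ⟨w, rfl⟩ := hv
      exact (hH.preconnected w₀ w).map (pendantExtensionHom H e w₀)
    · refine Adj.reachable (.inr ((fromRel_adj _ _ _).2 ⟨?_, .inl ⟨rfl, hv⟩⟩))
      rintro rfl
      exact hv ⟨w₀, rfl⟩
  have : Nonempty V := ⟨e w₀⟩
  exact ⟨fun u v => (key u).symm.trans (key v)⟩

lemma lt_copNumber_pendantExtension [Fintype V] {W : Type*} [Fintype W] [DecidableEq W]
    {H : SimpleGraph W} [DecidableRel H.Adj] (hc : NoShortEvenCycles H) {d : ℕ} (hd16 : 16 ≤ d)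
    (hd : ∀ x, #(H.neighborFinset x) = d) (e : W ↪ V) (w₀ : W) {t : ℕ} (ht : 4 ≤ t) :
    d ^ 4 < 1200 * copNumber (pendantExtension H e w₀) t := by
  have : Nonempty W := ⟨w₀⟩
  have hρ : ∀ x, Function.extend e id (fun _ => w₀) (e x) = x := fun x =>
    e.injective.extend_apply _ _ x
  have hout : ∀ v, v ∉ Set.range e → Function.extend e id (fun _ => w₀) v = w₀ := fun v hv =>
    Function.extend_apply' _ _ _ hv
  refine lt_copNumber_of_retract hc hd16 hd
    (pendantExtensionHom H e w₀) (Function.extend e id fun _ => w₀) hρ ?_ ht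
  rintro u v (h | h)
  · obtain ⟨x, y, hxy, rfl, rfl⟩ := (SimpleGraph.map_adj _ _ _ _).1 h
    rw [hρ, hρ]
    exact .inr hxy
  · left
    obtain ⟨-, ⟨rfl, hv⟩ | ⟨rfl, hu⟩⟩ := (fromRel_adj _ _ _).1 h
    · rw [hout _ hv, hρ]
    · rw [hout _ hu, hρ]

lemma hexGraph_noShortEvenCycles (K : Type*) [Field K] : NoShortEvenCycles (hexGraph K) :=
  ⟨hexGraph_no_four, hexGraph_no_six, hexGraph_no_eight, hexGraph_no_ten⟩

lemma exists_connected_lt_copNumber {q n t : ℕ} (hq : q.Prime) (hq16 : 16 ≤ q)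
    (hn : 2 * q ^ 5 ≤ n) (ht : 4 ≤ t) :
    ∃ G : SimpleGraph (Fin n), G.Connected ∧ q ^ 4 < 1200 * copNumber G t := by
  classical
  have : Fact q.Prime := ⟨hq⟩
  let x₀ : (Fin 5 → ZMod q) ⊕ (Fin 5 → ZMod q) := .inl 0
  let C := (hexGraph (ZMod q)).connectedComponentMk x₀
  let H : SimpleGraph C.supp := (hexGraph (ZMod q)).induce C.supp
  have : Fintype C.supp := Fintype.ofFinite _
  have hH : H.Connected := C.connected_toSimpleGraph
  have hcard : Fintype.card C.supp ≤ Fintype.card (Fin n) := by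
    refine (Fintype.card_le_of_injective _ Subtype.val_injective).trans ?_
    simp only [Fintype.card_sum, Fintype.card_fun, ZMod.card, Fintype.card_fin]
    omega
  obtain ⟨e⟩ := Function.Embedding.nonempty_of_card_le hcard
  have hdeg : ∀ x, #(H.neighborFinset x) = q := by
    intro x
    have := hexGraph_ncard_neighborSet (K := ZMod q) x.1
    rw [Nat.card_zmod] at this
    refine Eq.trans ?_ this
    rw [← Set.ncard_coe_finset, SimpleGraph.coe_neighborFinset,
      ← Set.ncard_image_of_injective _ Subtype.val_injective]
    congr 1
    ext y
    simp only [Set.mem_image, SimpleGraph.mem_neighborSet]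
    constructor
    · rintro ⟨z, hz, rfl⟩
      exact hz
    · intro hy
      exact ⟨⟨y, C.mem_supp_of_adj_mem_supp x.2 hy⟩, hy, rfl⟩
  let w₀ : C.supp := ⟨x₀, rfl⟩
  exact ⟨pendantExtension H e w₀, pendantExtension_connected hH e w₀,
    lt_copNumber_pendantExtension ((hexGraph_noShortEvenCycles _).of_injective_hom
      (Embedding.induce C.supp).toHom Subtype.val_injective) hq16 hdeg e w₀ ht⟩

lemma exists_prime_of_large {n : ℕ} (hn : 64 * 16 ^ 5 ≤ n) :
    ∃ q : ℕ, q.Prime ∧ 16 ≤ q ∧ 2 * q ^ 5 ≤ n ∧ n < 64 * q ^ 5 := by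
  let m := Nat.findGreatest (fun m => 64 * m ^ 5 ≤ n) n
  have hm : 64 * m ^ 5 ≤ n :=
    Nat.findGreatest_spec (P := fun m => 64 * m ^ 5 ≤ n) (m := 16) (by omega) hn
  have hm16 : 16 ≤ m := Nat.le_findGreatest (by omega) hn
  have hm' : n < 64 * (m + 1) ^ 5 := by
    by_contra! h
    have : m + 1 ≤ m := Nat.le_findGreatest
      ((Nat.le_self_pow (by omega) _).trans ((Nat.le_mul_of_pos_left _ (by omega)).trans h)) h
    omega
  obtain ⟨q, hq, hmq, hqm⟩ := Nat.exists_prime_lt_and_le_two_mul m (by omega)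
  refine ⟨q, hq, by omega, ?_, hm'.trans_le (by gcongr; omega)⟩
  calc 2 * q ^ 5 ≤ 2 * (2 * m) ^ 5 := by gcongr
    _ = 64 * m ^ 5 := by ring
    _ ≤ n := hm

end Construction

/-- For a fixed robber speed `t ≥ 4` there is a constant `c > 0` such that
for every `n ≥ 486` there is a connected graph on exactly `n` vertices whose speed-`t`
cop number is at least `c·n^(4/5)`. -/
theorem stmt3 (t : ℕ) (ht : 4 ≤ t) :
    ∃ c : ℝ, 0 < c ∧
      ∀ n : ℕ, 486 ≤ n →
        ∃ G : SimpleGraph (Fin n), G.Connected ∧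
          c * (n : ℝ) ^ ((4 : ℝ) / 5) ≤ (copNumber G t : ℝ) := by
  refine ⟨1 / (64 * 16 ^ 5), by norm_num, fun n hn => ?_⟩
  have hn1 : (1 : ℝ) ≤ n := by exact_mod_cast (by omega : 1 ≤ n)
  rcases le_or_gt (64 * 16 ^ 5) n with hlarge | hsmall
  · obtain ⟨q, hq, hq16, hqn, hnq⟩ := exists_prime_of_large hlarge
    obtain ⟨G, hG, hcop⟩ := exists_connected_lt_copNumber hq hq16 hqn ht
    refine ⟨G, hG, ?_⟩
    have hpow : (n : ℝ) ^ ((4 : ℝ) / 5) ≤ 64 * (q : ℝ) ^ 4 := by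
      calc (n : ℝ) ^ ((4 : ℝ) / 5) ≤ (64 * (q : ℝ) ^ 5) ^ ((4 : ℝ) / 5) := by
            gcongr
            exact_mod_cast hnq.le
        _ = 64 ^ ((4 : ℝ) / 5) * (q : ℝ) ^ 4 := by
            rw [Real.mul_rpow (by norm_num) (by positivity), ← Real.rpow_natCast_mul (by positivity)]
            norm_num
        _ ≤ 64 ^ (1 : ℝ) * (q : ℝ) ^ 4 := by
            gcongr <;> norm_num
        _ = _ := by rw [Real.rpow_one]
    have hcop' : (q : ℝ) ^ 4 < 1200 * copNumber G t := by exact_mod_cast hcop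
    linarith
  · have : NeZero n := ⟨by omega⟩
    refine ⟨⊤, connected_top, ?_⟩
    have hpow : (n : ℝ) ^ ((4 : ℝ) / 5) ≤ n :=
      (Real.rpow_le_rpow_of_exponent_le hn1 (by norm_num)).trans_eq (Real.rpow_one _)
    have hn' : (n : ℝ) < 64 * 16 ^ 5 := by exact_mod_cast hsmall
    have hcop : (1 : ℝ) ≤ copNumber (⊤ : SimpleGraph (Fin n)) t := by
      exact_mod_cast copNumber_pos (⊤ : SimpleGraph (Fin n)) t
    linarith
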